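/- arXiv:1909.10033 — 3 statements merged into one kernel-verified Lean document; each statement's English description precedes it below -/
import Mathlib

section
/- Assume n·d/(d + 1) is not an integer. Then k* = ⌊n·d/(d + 1)⌋ + 1 is the unique integer satisfying f_NC(k* − 2) < f_C(0) < f_NC(k* − 1), and moreover 2 ≤ k* ≤ n. -/
/-- Damage per player: φ = (d+1)/n. -/
noncomputable def phi (n : ℤ) (d : ℝ) : ℝ := (d + 1) / (n : ℝ)

/-- Non-CAV travel payoff: f_NC(k) = c − (n − k − 1)·φ. -/
noncomputable def fNC (n : ℤ) (c d : ℝ) (k : ℤ) : ℝ :=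
  c - ((n : ℝ) - (k : ℝ) - 1) * phi n d

/-- CAV travel payoff: f_C(k) = c + d − (n − k)·φ. -/
noncomputable def fC (n : ℤ) (c d : ℝ) (k : ℤ) : ℝ :=
  c + d - ((n : ℝ) - (k : ℝ)) * phi n d

theorem fC_zero {n : ℤ} (hn : n ≠ 0) (c d : ℝ) : fC n c d 0 = c - 1 := by
  have hn' : (n : ℝ) ≠ 0 := Int.cast_ne_zero.mpr hn
  unfold fC phi
  push_cast
  field_simp
  ring

theorem fNC_sub_fC_zero {n : ℤ} (hn : n ≠ 0) (c : ℝ) {d : ℝ} (hd : d + 1 ≠ 0) (k : ℤ) :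
    fNC n c d k - fC n c d 0 = ((k : ℝ) + 1 - n * d / (d + 1)) * phi n d := by
  have hn' : (n : ℝ) ≠ 0 := Int.cast_ne_zero.mpr hn
  rw [fC_zero hn]
  unfold fNC phi
  field_simp
  ring

theorem phi_pos {n : ℤ} (hn : 0 < n) {d : ℝ} (hd : 0 < d + 1) : 0 < phi n d :=
  div_pos hd (Int.cast_pos.mpr hn)

theorem fNC_lt_fC_zero_iff {n : ℤ} (hn : 0 < n) (c : ℝ) {d : ℝ} (hd : 0 < d + 1) (k : ℤ) :
    fNC n c d k < fC n c d 0 ↔ (k : ℝ) + 1 < n * d / (d + 1) := by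
  rw [← sub_neg, fNC_sub_fC_zero hn.ne' c hd.ne', ← neg_pos, ← neg_mul,
    mul_pos_iff_of_pos_right (phi_pos hn hd), neg_pos, sub_neg]

theorem fC_zero_lt_fNC_iff {n : ℤ} (hn : 0 < n) (c : ℝ) {d : ℝ} (hd : 0 < d + 1) (k : ℤ) :
    fC n c d 0 < fNC n c d k ↔ n * d / (d + 1) < (k : ℝ) + 1 := by
  rw [← sub_pos, fNC_sub_fC_zero hn.ne' c hd.ne', mul_pos_iff_of_pos_right (phi_pos hn hd),
    sub_pos]

/-- if n·d/(d + 1) is not an integer then k* = ⌊n·d/(d + 1)⌋ + 1 is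
the unique integer with f_NC(k* − 2) < f_C(0) < f_NC(k* − 1), and 2 ≤ k* ≤ n. -/
theorem kstar_unique (n : ℤ) (c d : ℝ) (hn : 2 < n)
    (hc : 0 < c) (hd : 0 < d) (hdn : d * ((n : ℝ) - 2) > 2) (hcd : c > d + 1)
    (hni : ¬ ∃ m : ℤ, (n : ℝ) * d / (d + 1) = (m : ℝ)) :
    (fNC n c d ((⌊(n : ℝ) * d / (d + 1)⌋ + 1) - 2) < fC n c d 0 ∧
      fC n c d 0 < fNC n c d ((⌊(n : ℝ) * d / (d + 1)⌋ + 1) - 1)) ∧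
    (∀ k : ℤ,
      (fNC n c d (k - 2) < fC n c d 0 ∧ fC n c d 0 < fNC n c d (k - 1)) →
        k = ⌊(n : ℝ) * d / (d + 1)⌋ + 1) ∧
    2 ≤ ⌊(n : ℝ) * d / (d + 1)⌋ + 1 ∧ ⌊(n : ℝ) * d / (d + 1)⌋ + 1 ≤ n := by
  have hn0 : 0 < n := by omega
  have hd1 : 0 < d + 1 := by linarith
  have hnR : (0 : ℝ) < n := Int.cast_pos.mpr hn0
  simp only [fNC_lt_fC_zero_iff hn0 c hd1, fC_zero_lt_fNC_iff hn0 c hd1]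
  have one_le : 1 ≤ (n : ℝ) * d / (d + 1) := by
    rw [le_div_iff₀ hd1]
    linarith
  have lt_n : (n : ℝ) * d / (d + 1) < n := by
    rw [div_lt_iff₀ hd1]
    linarith
  generalize (n : ℝ) * d / (d + 1) = x at *
  have floor_lt : (⌊x⌋ : ℝ) < x :=
    (Int.floor_le x).lt_of_ne fun h => hni ⟨⌊x⌋, h.symm⟩
  have lt_floor := Int.lt_floor_add_one x
  refine ⟨⟨?_, ?_⟩, fun k hk => ?_, ?_, ?_⟩
  · push_cast
    linarith
  · push_cast
    linarith
  · have hfloor : ⌊x⌋ = k - 1 := by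
      rw [Int.floor_eq_iff]
      push_cast at hk ⊢
      constructor <;> linarith [hk.1, hk.2]
    omega
  · have : 1 ≤ ⌊x⌋ := Int.le_floor.mpr (by exact_mod_cast one_le)
    omega
  · have : ⌊x⌋ < n := Int.floor_lt.mpr lt_n
    omega
end

section
/- Let k* = ⌊n·d/(d + 1)⌋ + 1 and assume n·d/(d + 1) is not an integer. Then for every integer k' with k* − 1 ≤ k' ≤ n − 1, one has f_NC(k') > f_C(0); that is, every outcome with at least k* − 1 other non-CAV travelers Pareto dominates universal CAV travel. -/
/-- with k* = ⌊n·d/(d + 1)⌋ + 1 (and n·d/(d + 1) not an integer),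
every outcome with k* − 1 ≤ k' ≤ n − 1 satisfies f_NC(k') > f_C(0), i.e. Pareto
dominates universal CAV travel. -/
theorem pareto_dominating_outcomes (n : ℤ) (c d : ℝ) (hn : 2 < n)
    (hc : 0 < c) (hd : 0 < d) (hdn : d * ((n : ℝ) - 2) > 2) (hcd : c > d + 1)
    (hni : ¬ ∃ m : ℤ, (n : ℝ) * d / (d + 1) = (m : ℝ)) :
    ∀ k' : ℤ, (⌊(n : ℝ) * d / (d + 1)⌋ + 1) - 1 ≤ k' → k' ≤ n - 1 →
      fNC n c d k' > fC n c d 0 := by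
  intro k' hk _
  have hn0 : (0 : ℝ) < n := by exact_mod_cast (by omega : (0 : ℤ) < n)
  have hd1 : 0 < d + 1 := by linarith
  have hlt : (n : ℝ) * d / (d + 1) < (k' : ℝ) + 1 := by
    have hfloor : ((⌊(n : ℝ) * d / (d + 1)⌋ : ℤ) : ℝ) ≤ k' := by
      exact_mod_cast (by linarith : ⌊(n : ℝ) * d / (d + 1)⌋ ≤ k')
    linarith [Int.lt_floor_add_one ((n : ℝ) * d / (d + 1))]
  rw [div_lt_iff₀ hd1] at hlt
  have hdamage : ((n : ℝ) - k' - 1) * phi n d < 1 := by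
    rw [phi, ← mul_div_assoc, div_lt_one hn0]
    linarith
  have hphi : (n : ℝ) * phi n d = d + 1 := by
    rw [phi]
    field_simp
  simp only [fNC, fC, Int.cast_zero, sub_zero, hphi]
  linarith
end

section
/- If k is an integer with 2·k > n and k ≤ n, then n·[(k − 1)·f_C(k) − k·f_C(k − 1)] + [n·f_C(k − 1) − (k − 1)·α]·(2·k − n) > 0. Consequently, the necessary condition for an equilibrium coalition of k non-CAV travelers holds whenever at least half of the players non-CAV travel. -/
/-- if 2·k > n and k ≤ n, then
n·[(k − 1)·f_C(k) − k·f_C(k − 1)] + [n·f_C(k − 1) − (k − 1)·α]·(2·k − n) > 0,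
where α = d − φ; i.e. the necessary condition for an equilibrium coalition of k
non-CAV travelers holds whenever at least half of the players non-CAV travel. -/
theorem majority_coalition_condition (n : ℤ) (c d : ℝ) (hn : 2 < n)
    (hc : 0 < c) (hd : 0 < d) (hdn : d * ((n : ℝ) - 2) > 2) (hcd : c > d + 1) :
    ∀ k : ℤ, 2 * k > n → k ≤ n →
      (n : ℝ) * (((k : ℝ) - 1) * fC n c d k - (k : ℝ) * fC n c d (k - 1)) +
        ((n : ℝ) * fC n c d (k - 1) - ((k : ℝ) - 1) * (d - phi n d)) *
          (2 * (k : ℝ) - (n : ℝ)) > 0 := by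
  intro k hk _
  have hn' : (2 : ℝ) < n := by exact_mod_cast hn
  have hk2 : (2 : ℝ) ≤ k := by
    have : (2 : ℤ) ≤ k := by omega
    exact_mod_cast this
  have hm : (0 : ℝ) ≤ 2 * (k : ℝ) - n - 1 := by
    have : n + 1 ≤ 2 * k := by omega
    have : (n : ℝ) + 1 ≤ 2 * k := by exact_mod_cast this
    linarith
  have hφ : 0 < phi n d := by unfold phi; positivity
  have hnφ : (n : ℝ) * phi n d = d + 1 := by unfold phi; field_simp
  unfold fC
  push_cast
  generalize phi n d = φ at hφ hnφ ⊢
  have hgap : 0 ≤ (n : ℝ) * (c + d) - ((n : ℝ) - k + 1) * (d + 1) - ((k : ℝ) - 1) * (d - φ) := by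
    have h₁ : 0 ≤ (n : ℝ) * (c - d - 1) := mul_nonneg (by linarith) (by linarith)
    have h₂ : 0 ≤ ((k : ℝ) - 1) * (1 + φ) := mul_nonneg (by linarith) (by linarith)
    have h₃ : 0 ≤ (n : ℝ) * d := mul_nonneg (by linarith) hd.le
    linarith
  have hprod := mul_nonneg hm hgap
  have hpos : 0 < ((k : ℝ) - 1) * (1 + φ) := mul_pos (by linarith) (by linarith)
  linear_combination (exp := 1) hprod + hpos +
    (((n : ℝ) - k + 1) * (2 * (k : ℝ) - n - 1) - ((k : ℝ) - 1)) * hnφ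
end
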